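/- For any isometric immersion x: M → 𝔼^m of a Riemannian n-manifold M into a Euclidean m-space, the squared mean curvature satisfies H² ≥ Δ̂₀(M) at each point p ∈ M, where Δ̂₀(M) is the maximum over all admissible tuples (n₁,…,n_k) of the normalized δ-invariants δ(n₁,…,n_k)/c(n₁,…,n_k). -/

import Mathlib

noncomputable section

open scoped RealInnerProductSpace BigOperators

/-- We identify the tangent space at each point of a Riemannian `n`-manifold with
the Euclidean space `ℝⁿ` (via a choice of orthonormal frame). -/
abbrev EucSp (n : ℕ) := EuclideanSpace ℝ (Fin n)

/-- The data of a Riemannian `n`-manifold recorded through the quantities entering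
Chen's theory of `δ`-invariants: the underlying topological space together with,
at each point, the Riemann curvature tensor expressed in an orthonormal frame, so
that for orthonormal vectors `u, v` the number `R p u v u v` is the sectional
curvature `K(u ∧ v)` of the plane spanned by `u` and `v` at `p`. -/
structure GeomData (n : ℕ) where
  /-- the underlying set of points -/
  M : Type
  /-- the underlying topology -/
  [top : TopologicalSpace M]
  /-- the Riemann curvature tensor (in orthonormal frames) -/
  R : M → EucSp n → EucSp n → EucSp n → EucSp n → ℝ

attribute [instance] GeomData.top

/-- A Riemannian manifold together with its Laplace–Beltrami operator `Δ`
acting on (smooth) real valued functions. -/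
structure RiemannData (n : ℕ) extends GeomData n where
  /-- the Laplace–Beltrami operator -/
  lap : (M → ℝ) → (M → ℝ)

variable {n : ℕ}

/-- The scalar curvature `τ(L) = ∑_{α<β} K(e_α ∧ e_β)` of a subspace
`L ⊆ T_pM`, computed with respect to an orthonormal basis `e_1, …, e_r` of `L`. -/
def GeomData.subScal (X : GeomData n) (p : X.M) (L : Submodule ℝ (EucSp n)) : ℝ :=
  ∑ i : Fin (Module.finrank ℝ L), ∑ j : Fin (Module.finrank ℝ L),
    if (i : ℕ) < (j : ℕ) then
      X.R p (stdOrthonormalBasis ℝ L i : EucSp n) (stdOrthonormalBasis ℝ L j : EucSp n)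
        (stdOrthonormalBasis ℝ L i : EucSp n) (stdOrthonormalBasis ℝ L j : EucSp n)
    else 0

/-- The scalar curvature `τ(p) = ∑_{i<j} K(e_i ∧ e_j)` at a point `p`. -/
def GeomData.scal (X : GeomData n) (p : X.M) : ℝ :=
  X.subScal p ⊤

/-- An admissible tuple `(n₁, …, n_k)` in Chen's set `𝒮(n)`: an (unordered) tuple
of integers `≥ 2`, each `< n`, with `n₁ + ⋯ + n_k ≤ n`.  The empty tuple (`k = 0`),
corresponding to the trivial invariant `δ(∅) = τ`, is allowed. -/
structure ChenTuple (n : ℕ) where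
  /-- the length of the tuple -/
  k : ℕ
  /-- the entries `n₁, …, n_k` -/
  nn : Fin k → ℕ
  two_le : ∀ j, 2 ≤ nn j
  lt_n : ∀ j, nn j < n
  sum_le : ∑ j, nn j ≤ n

/-- The normalizing constant
`c(n₁,…,n_k) = n²(n + k - 1 - ∑ n_j) / (2(n + k - ∑ n_j))`. -/
def ChenTuple.c {n : ℕ} (t : ChenTuple n) : ℝ :=
  ((n : ℝ) ^ 2 * ((n : ℝ) + (t.k : ℝ) - 1 - ∑ j, (t.nn j : ℝ))) /
    (2 * ((n : ℝ) + (t.k : ℝ) - ∑ j, (t.nn j : ℝ)))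

/-- A family of subspaces of the tangent space is mutually orthogonal if vectors
belonging to different members are orthogonal. -/
def MutuallyOrthogonal {n k : ℕ} (L : Fin k → Submodule ℝ (EucSp n)) : Prop :=
  ∀ i j, i ≠ j → ∀ u ∈ L i, ∀ v ∈ L j, ⟪u, v⟫ = 0

/-- Chen's `δ`-invariant
`δ(n₁,…,n_k)(p) = τ(p) - inf { τ(L₁) + ⋯ + τ(L_k) }`, the infimum being taken
over all families of mutually orthogonal subspaces `L₁, …, L_k` of `T_pM` with
`dim L_j = n_j`. -/
def GeomData.delta (X : GeomData n) (t : ChenTuple n) (p : X.M) : ℝ :=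
  X.scal p - sInf { s : ℝ |
    ∃ L : Fin t.k → Submodule ℝ (EucSp n),
      (∀ j, Module.finrank ℝ (L j) = t.nn j) ∧
      MutuallyOrthogonal L ∧
      s = ∑ j, X.subScal p (L j) }

/-- The maximal normalized `δ`-invariant
`Δ̂₀(M)(p) = max { δ(n₁,…,n_k)(p) / c(n₁,…,n_k) : (n₁,…,n_k) ∈ 𝒮(n) }`. -/
def GeomData.Delta0 (X : GeomData n) (p : X.M) : ℝ :=
  sSup { r : ℝ | ∃ t : ChenTuple n, r = X.delta t p / t.c }

/-- An isometric immersion of the Riemannian `n`-manifold `X` into the Euclidean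
`m`-space `𝔼^m`, recorded through its underlying (continuous) map `x` and its
second fundamental form `h` --- a symmetric bilinear map at each point, expressed
in orthonormal frames --- which is tied to the intrinsic curvature of `X` by the
equation of Gauss for submanifolds of Euclidean space. -/
structure IsometricImmersion (m : ℕ) {n : ℕ} (X : GeomData n) where
  /-- the underlying map into `𝔼^m` -/
  x : X.M → EucSp m
  continuous_x : Continuous x
  /-- the second fundamental form -/
  h : X.M → EucSp n →ₗ[ℝ] EucSp n →ₗ[ℝ] EucSp m
  h_symm : ∀ p u v, h p u v = h p v u
  /-- the equation of Gauss (for a Euclidean ambient space): it expresses that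
  `x` is an isometric immersion with second fundamental form `h`. -/
  gauss : ∀ p u v w z,
    X.R p u v w z = ⟪h p u w, h p v z⟫ - ⟪h p u z, h p v w⟫

/-- The mean curvature vector `H⃗ = (1/n) trace h` of an isometric immersion. -/
def IsometricImmersion.meanCurvVec {m : ℕ} {X : GeomData n}
    (ι : IsometricImmersion m X) (p : X.M) : EucSp m :=
  (n : ℝ)⁻¹ • ∑ i, ι.h p (EuclideanSpace.basisFun (Fin n) ℝ i)
      (EuclideanSpace.basisFun (Fin n) ℝ i)

/-- An isometric immersion is *ideal* if its squared mean curvature satisfies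
`H² = Δ̂₀(M)` identically. -/
def IsometricImmersion.IsIdeal {m : ℕ} {X : GeomData n}
    (ι : IsometricImmersion m X) : Prop :=
  ∀ p, ‖ι.meanCurvVec p‖ ^ 2 = X.Delta0 p

/-- `μ` is an eigenvalue of the Laplace–Beltrami operator of `X` if it has a
nonzero (continuous) eigenfunction. -/
def RiemannData.IsEigenvalue (X : RiemannData n) (μ : ℝ) : Prop :=
  ∃ f : X.M → ℝ, Continuous f ∧ f ≠ 0 ∧ X.lap f = μ • f

/-- The first positive eigenvalue `λ₁` of the Laplace–Beltrami operator. -/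
def RiemannData.lambda1 (X : RiemannData n) : ℝ :=
  sInf { μ : ℝ | 0 < μ ∧ X.IsEigenvalue μ }

/-- A Riemannian covering map `π : X → Y`: a topological covering map which is a
local isometry.  Its differential at each point is a linear isometry between
tangent spaces (expressed in the orthonormal frames) which intertwines the
curvature tensors, and lifting functions along `π` intertwines the
Laplace–Beltrami operators. -/
structure RiemannianCovering (X Y : RiemannData n) where
  /-- the underlying covering map -/
  π : X.M → Y.M
  covering : IsCoveringMap π
  /-- the differential of `π` (a linear isometry, since `π` is a local isometry) -/
  d : X.M → (EucSp n ≃ₗᵢ[ℝ] EucSp n)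
  compat_R : ∀ p u v w z,
    Y.R (π p) (d p u) (d p v) (d p w) (d p z) = X.R p u v w z
  compat_lap : ∀ f : Y.M → ℝ, X.lap (f ∘ π) = (Y.lap f) ∘ π

/-- An isometry of the Riemannian manifold `X`: a homeomorphism whose
differential at each point is a linear isometry of tangent spaces intertwining
the curvature tensor, and which commutes with the Laplace–Beltrami operator. -/
structure IsomData (X : RiemannData n) where
  /-- the underlying homeomorphism -/
  toHomeomorph : X.M ≃ₜ X.M
  /-- the differential -/
  d : X.M → (EucSp n ≃ₗᵢ[ℝ] EucSp n)
  compat_R : ∀ p u v w z,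
    X.R (toHomeomorph p) (d p u) (d p v) (d p w) (d p z) = X.R p u v w z
  compat_lap : ∀ f : X.M → ℝ, X.lap (f ∘ toHomeomorph) = (X.lap f) ∘ toHomeomorph

/-- A Riemannian manifold is homogeneous if its group of isometries acts
transitively. -/
def IsHomogeneous (X : RiemannData n) : Prop :=
  ∀ p q : X.M, ∃ φ : IsomData X, φ.toHomeomorph p = q

/-- A Riemannian manifold has irreducible isotropy action if, at every point `p`,
the only subspaces of the tangent space `T_pM` invariant under the differentials
of all isometries fixing `p` are `0` and `T_pM`. -/
def HasIrreducibleIsotropy (X : RiemannData n) : Prop :=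
  ∀ p : X.M, ∀ W : Submodule ℝ (EucSp n),
    (∀ φ : IsomData X, φ.toHomeomorph p = p →
      W.map ((φ.d p).toLinearEquiv : EucSp n →ₗ[ℝ] EucSp n) = W) →
    W = ⊥ ∨ W = ⊤

/-- A Riemannian manifold has constant sectional curvature one iff its curvature
tensor is `R(u,v,w,z) = ⟪u,w⟫⟪v,z⟫ - ⟪u,z⟫⟪v,w⟫`. -/
def ConstantCurvatureOne (X : GeomData n) : Prop :=
  ∀ p u v w z, X.R p u v w z = ⟪u, w⟫ * ⟪v, z⟫ - ⟪u, z⟫ * ⟪v, w⟫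

section BilinearTrace

variable {E F : Type*} [NormedAddCommGroup E] [InnerProductSpace ℝ E]

/-- The trace of a bilinear map with respect to an orthonormal basis does not depend on
the basis. -/
lemma OrthonormalBasis.sum_bilin_self_eq [AddCommGroup F] [Module ℝ F] {α β : Type*}
    [Fintype α] [Fintype β] (b : OrthonormalBasis α ℝ E) (c : OrthonormalBasis β ℝ E)
    (B : E →ₗ[ℝ] E →ₗ[ℝ] F) :
    ∑ i, B (b i) (b i) = ∑ j, B (c j) (c j) := by
  classical
  have expand : ∀ i, B (b i) (b i) =
      ∑ j, ∑ l, (⟪c j, b i⟫ * ⟪b i, c l⟫) • B (c j) (c l) := by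
    intro i
    conv_lhs => rw [← c.sum_repr' (b i)]
    simp only [map_sum, map_smul, LinearMap.sum_apply, LinearMap.smul_apply, Finset.smul_sum,
      smul_smul]
    rw [Finset.sum_comm]
    refine Finset.sum_congr rfl fun j _ => Finset.sum_congr rfl fun l _ => ?_
    rw [real_inner_comm (c l) (b i)]
    rw [mul_comm]
  calc ∑ i, B (b i) (b i)
      = ∑ j, ∑ l, (∑ i, ⟪c j, b i⟫ * ⟪b i, c l⟫) • B (c j) (c l) := by
        simp only [expand, Finset.sum_smul]
        rw [Finset.sum_comm]
        exact Finset.sum_congr rfl fun j _ => Finset.sum_comm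
    _ = ∑ j, B (c j) (c j) := by
        simp [b.sum_inner_mul_inner, orthonormal_iff_ite.mp c.orthonormal, ite_smul]

/-- The squared Hilbert–Schmidt norm of a bilinear map does not depend on the
orthonormal basis. -/
lemma OrthonormalBasis.sum_norm_sq_bilin_eq [NormedAddCommGroup F] [InnerProductSpace ℝ F]
    {α β : Type*} [Fintype α] [Fintype β]
    (b : OrthonormalBasis α ℝ E) (c : OrthonormalBasis β ℝ E) (B : E →ₗ[ℝ] E →ₗ[ℝ] F) :
    ∑ i, ∑ j, ‖B (b i) (b j)‖ ^ 2 = ∑ i, ∑ j, ‖B (c i) (c j)‖ ^ 2 := by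
  have snd : ∀ u, ∑ j, ‖B u (b j)‖ ^ 2 = ∑ j, ‖B u (c j)‖ ^ 2 := fun u => by
    simpa [real_inner_self_eq_norm_sq] using
      b.sum_bilin_self_eq c ((innerₗ F).compl₁₂ (B u) (B u))
  have fst : ∀ v, ∑ i, ‖B (b i) v‖ ^ 2 = ∑ i, ‖B (c i) v‖ ^ 2 := fun v => by
    simpa [real_inner_self_eq_norm_sq] using
      b.sum_bilin_self_eq c ((innerₗ F).compl₁₂ (B.flip v) (B.flip v))
  simp only [snd]
  rw [Finset.sum_comm, Finset.sum_comm (γ := β) (f := fun i j => ‖B (c i) (c j)‖ ^ 2)]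
  exact Finset.sum_congr rfl fun j _ => fst (c j)

end BilinearTrace

/-- Twice the sum of a symmetric array over pairs `i < j` is its full sum, if the diagonal
vanishes. -/
lemma two_mul_sum_lt_eq_sum {r : ℕ} (f : Fin r → Fin r → ℝ) (symm : ∀ i j, f i j = f j i)
    (diag : ∀ i, f i i = 0) :
    2 * (∑ i : Fin r, ∑ j : Fin r, if (i : ℕ) < (j : ℕ) then f i j else 0) =
      ∑ i, ∑ j, f i j := by
  have swap : (∑ i : Fin r, ∑ j : Fin r, if (i : ℕ) < (j : ℕ) then f i j else 0) =
      ∑ i : Fin r, ∑ j : Fin r, if (j : ℕ) < (i : ℕ) then f i j else 0 := by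
    rw [Finset.sum_comm]
    simp only [symm]
  rw [two_mul]
  nth_rewrite 2 [swap]
  simp only [← Finset.sum_add_distrib]
  refine Finset.sum_congr rfl fun i _ => Finset.sum_congr rfl fun j _ => ?_
  rcases lt_trichotomy (i : ℕ) j with hij | hij | hij
  · simp [hij, hij.not_gt]
  · obtain rfl := Fin.ext hij
    simp [diag]
  · simp [hij, hij.not_gt]

/-- An orthogonal sum of orthonormal bases of mutually orthogonal subspaces, completed to an
orthonormal basis of the whole space. -/
lemma MutuallyOrthogonal.exists_adapted_orthonormalBasis {k : ℕ}
    {L : Fin k → Submodule ℝ (EucSp n)} (hL : MutuallyOrthogonal L) {s : ℕ}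
    (hs : ∑ j, Module.finrank ℝ (L j) + s = n) :
    ∃ b : OrthonormalBasis ((Σ j, Fin (Module.finrank ℝ (L j))) ⊕ Fin s) ℝ (EucSp n),
      ∀ j a, b (Sum.inl ⟨j, a⟩) = stdOrthonormalBasis ℝ (L j) a := by
  classical
  let v : (Σ j, Fin (Module.finrank ℝ (L j))) ⊕ Fin s → EucSp n :=
    Sum.elim (fun x => (stdOrthonormalBasis ℝ (L x.1) x.2 : EucSp n)) 0
  have hv : Orthonormal ℝ ((Set.range Sum.inl).domRestrict v) := by
    constructor
    · rintro ⟨_, ⟨⟨j, a⟩, rfl⟩⟩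
      exact (stdOrthonormalBasis ℝ (L j)).orthonormal.1 a
    · rintro ⟨_, ⟨⟨j, a⟩, rfl⟩⟩ ⟨_, ⟨⟨j', a'⟩, rfl⟩⟩ hne
      by_cases hj : j = j'
      · subst hj
        refine (stdOrthonormalBasis ℝ (L j)).orthonormal.2 fun h => hne ?_
        obtain rfl : a = a' := h
        rfl
      · exact hL j j' hj _ (Subtype.prop _) _ (Subtype.prop _)
  obtain ⟨b, hb⟩ := hv.exists_orthonormalBasis_extension_of_card_eq (by simp [hs])
  exact ⟨b, fun j a => hb _ ⟨_, rfl⟩⟩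

/-- Mutually orthogonal subspaces of prescribed dimensions exist if these dimensions sum to at
most `n`. -/
lemma exists_mutuallyOrthogonal {k : ℕ} (d : Fin k → ℕ) (hd : ∑ j, d j ≤ n) :
    ∃ L : Fin k → Submodule ℝ (EucSp n),
      (∀ j, Module.finrank ℝ (L j) = d j) ∧ MutuallyOrthogonal L := by
  classical
  obtain ⟨f⟩ : Nonempty ((Σ j, Fin (d j)) ↪ Fin n) :=
    Function.Embedding.nonempty_of_card_le (by simpa using hd)
  let e : (Σ j, Fin (d j)) → EucSp n := fun x => EuclideanSpace.basisFun (Fin n) ℝ (f x)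
  have he : Orthonormal ℝ e := (EuclideanSpace.basisFun (Fin n) ℝ).orthonormal.comp f f.injective
  refine ⟨fun j => Submodule.span ℝ (Set.range fun a => e ⟨j, a⟩), fun j => ?_, ?_⟩
  · have hli := (he.comp (fun a : Fin (d j) => (⟨j, a⟩ : Σ j, Fin (d j)))
      (fun _ _ h => eq_of_heq (Sigma.mk.inj h).2)).linearIndependent
    simpa [Function.comp_def] using finrank_span_eq_card hli
  · intro i j hij
    have : Submodule.span ℝ (Set.range fun a => e ⟨i, a⟩) ⟂
        Submodule.span ℝ (Set.range fun a => e ⟨j, a⟩) := by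
      rw [Submodule.isOrtho_span]
      rintro _ ⟨a, rfl⟩ _ ⟨a', rfl⟩
      exact he.2 fun h => hij (congrArg Sigma.fst h)
    exact fun u hu v hv => Submodule.isOrtho_iff_inner_eq.mp this u hu v hv

lemma ChenTuple.c_nonneg (t : ChenTuple n) : 0 ≤ t.c := by
  have hsum : (∑ j, (t.nn j : ℝ)) ≤ n := by exact_mod_cast t.sum_le
  unfold ChenTuple.c
  rcases Nat.eq_zero_or_pos n with rfl | hn
  · simp
  have hn' : (1 : ℝ) ≤ n := by exact_mod_cast hn
  rcases Nat.eq_zero_or_pos t.k with hk | hk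
  · have h0 : (∑ j, (t.nn j : ℝ)) = 0 := by
      have : IsEmpty (Fin t.k) := by rw [hk]; infer_instance
      exact Finset.sum_of_isEmpty _
    rw [h0, hk]
    apply div_nonneg
    · exact mul_nonneg (sq_nonneg _) (by push_cast; linarith)
    · push_cast; linarith
  · have hk' : (1 : ℝ) ≤ t.k := by exact_mod_cast hk
    apply div_nonneg
    · exact mul_nonneg (sq_nonneg _) (by linarith)
    · linarith

lemma ChenTuple.c_mul_eq (t : ChenTuple n) {s : ℕ} (hs : ∑ j, t.nn j + s = n) (x : ℝ) :
    t.c * x = ((t.k : ℝ) + s - 1) / (2 * ((t.k : ℝ) + s)) * ((n : ℝ) ^ 2 * x) := by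
  have hs' : (n : ℝ) = ∑ j, (t.nn j : ℝ) + s := by exact_mod_cast hs.symm
  have h₁ : (n : ℝ) + t.k - 1 - ∑ j, (t.nn j : ℝ) = t.k + s - 1 := by rw [hs']; ring
  have h₂ : (n : ℝ) + t.k - ∑ j, (t.nn j : ℝ) = t.k + s := by rw [hs']; ring
  rw [ChenTuple.c, h₁, h₂]
  ring

lemma le_of_le_mul_of_two_mul_le {k s : ℕ} {x S D : ℝ} (hx : x ≤ ((k : ℝ) + s) * S)
    (hS : 0 ≤ S) (hD : 2 * D ≤ x - S) :
    D ≤ ((k : ℝ) + s - 1) / (2 * ((k : ℝ) + s)) * x := by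
  rcases Nat.eq_zero_or_pos (k + s) with h | h
  · have h' : (k : ℝ) + s = 0 := by exact_mod_cast h
    rw [h'] at hx ⊢
    simp only [mul_zero, div_zero, zero_mul] at hx ⊢
    linarith
  · have h' : (0 : ℝ) < (k : ℝ) + s := by exact_mod_cast h
    rw [div_mul_eq_mul_div, le_div_iff₀ (by positivity)]
    nlinarith [mul_le_mul_of_nonneg_left hD h'.le]

namespace IsometricImmersion

variable {m : ℕ} {X : GeomData n}

/-- The Gauss equation, traced over a subspace: `2 τ(L) = ‖tr_L h‖² - ‖h|_L‖²`. -/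
lemma two_mul_subScal (ι : IsometricImmersion m X) (p : X.M) (L : Submodule ℝ (EucSp n)) :
    2 * X.subScal p L =
      ‖∑ i, ι.h p (stdOrthonormalBasis ℝ L i) (stdOrthonormalBasis ℝ L i)‖ ^ 2 -
        ∑ i, ∑ j, ‖ι.h p (stdOrthonormalBasis ℝ L i) (stdOrthonormalBasis ℝ L j)‖ ^ 2 := by
  unfold GeomData.subScal
  rw [two_mul_sum_lt_eq_sum (fun i j => X.R p (stdOrthonormalBasis ℝ L i : EucSp n)
    (stdOrthonormalBasis ℝ L j : EucSp n) (stdOrthonormalBasis ℝ L i : EucSp n)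
    (stdOrthonormalBasis ℝ L j : EucSp n))]
  · rw [← real_inner_self_eq_norm_sq, sum_inner, ← Finset.sum_sub_distrib]
    refine Finset.sum_congr rfl fun i _ => ?_
    rw [inner_sum, ← Finset.sum_sub_distrib]
    refine Finset.sum_congr rfl fun j _ => ?_
    rw [ι.gauss, ι.h_symm p (stdOrthonormalBasis ℝ L j : EucSp n) (stdOrthonormalBasis ℝ L i),
      real_inner_self_eq_norm_sq]
  · intro i j
    rw [ι.gauss, ι.gauss, real_inner_comm,
      real_inner_comm (ι.h p (stdOrthonormalBasis ℝ L i) (stdOrthonormalBasis ℝ L j))]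
  · intro i
    rw [ι.gauss, sub_self]

/-- The Gauss equation, traced over the tangent space: `2 τ = ‖tr h‖² - ‖h‖²`, in any
orthonormal basis. -/
lemma two_mul_scal (ι : IsometricImmersion m X) (p : X.M) {α : Type*} [Fintype α]
    (b : OrthonormalBasis α ℝ (EucSp n)) :
    2 * X.scal p = ‖∑ i, ι.h p (b i) (b i)‖ ^ 2 - ∑ i, ∑ j, ‖ι.h p (b i) (b j)‖ ^ 2 := by
  let c := (stdOrthonormalBasis ℝ (⊤ : Submodule ℝ (EucSp n))).map
    (LinearIsometryEquiv.ofTop (EucSp n) ⊤ rfl)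
  rw [GeomData.scal, two_mul_subScal ι, b.sum_bilin_self_eq c, b.sum_norm_sq_bilin_eq c]
  rfl

lemma sq_mul_norm_meanCurvVec_sq (ι : IsometricImmersion m X) (p : X.M) {α : Type*} [Fintype α]
    (b : OrthonormalBasis α ℝ (EucSp n)) :
    (n : ℝ) ^ 2 * ‖ι.meanCurvVec p‖ ^ 2 = ‖∑ i, ι.h p (b i) (b i)‖ ^ 2 := by
  rw [meanCurvVec, ← b.sum_bilin_self_eq, norm_smul, mul_pow, ← mul_assoc, ← mul_pow]
  rcases Nat.eq_zero_or_pos n with rfl | hn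
  · rw [b.sum_bilin_self_eq (EuclideanSpace.basisFun (Fin 0) ℝ)]
    simp
  · have : (n : ℝ) ≠ 0 := by positivity
    simp [this]

/-- Chen's inequality for a fixed family of mutually orthogonal subspaces. -/
lemma scal_sub_sum_subScal_le (ι : IsometricImmersion m X) (p : X.M) (t : ChenTuple n)
    (L : Fin t.k → Submodule ℝ (EucSp n)) (hdim : ∀ j, Module.finrank ℝ (L j) = t.nn j)
    (hL : MutuallyOrthogonal L) :
    X.scal p - ∑ j, X.subScal p (L j) ≤ t.c * ‖ι.meanCurvVec p‖ ^ 2 := by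
  obtain ⟨s, hs⟩ : ∃ s, ∑ j, Module.finrank ℝ (L j) + s = n := by
    obtain ⟨s, hs⟩ := Nat.exists_eq_add_of_le t.sum_le
    exact ⟨s, by simp only [hdim, hs.symm]⟩
  obtain ⟨b, hb⟩ := hL.exists_adapted_orthonormalBasis hs
  set e : ∀ j, Fin (Module.finrank ℝ (L j)) → EucSp n :=
    fun j a => stdOrthonormalBasis ℝ (L j) a with he
  set T : EucSp m := ∑ i, ι.h p (b i) (b i) with hT
  let A : Fin t.k ⊕ Fin s → EucSp m :=
    Sum.elim (fun j => ∑ a, ι.h p (e j a) (e j a))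
      (fun l => ι.h p (b (Sum.inr l)) (b (Sum.inr l)))
  have hTA : T = ∑ x, A x := by
    simp [hT, A, Fintype.sum_sum_type, Fintype.sum_sigma, hb, he]
  have hsq : ∑ j, ∑ a, ∑ a', ‖ι.h p (e j a) (e j a')‖ ^ 2 +
      ∑ l, ‖A (Sum.inr l)‖ ^ 2 ≤ ∑ i, ∑ i', ‖ι.h p (b i) (b i')‖ ^ 2 := by
    rw [Fintype.sum_sum_type, Fintype.sum_sigma]
    refine add_le_add (Finset.sum_le_sum fun j _ => Finset.sum_le_sum fun a _ => ?_)
      (Finset.sum_le_sum fun l _ => ?_)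
    · rw [Fintype.sum_sum_type, Fintype.sum_sigma]
      calc ∑ a', ‖ι.h p (e j a) (e j a')‖ ^ 2
          = ∑ a', ‖ι.h p (b (Sum.inl ⟨j, a⟩)) (b (Sum.inl ⟨j, a'⟩))‖ ^ 2 := by simp [hb, he]
        _ ≤ ∑ j', ∑ a', ‖ι.h p (b (Sum.inl ⟨j, a⟩)) (b (Sum.inl ⟨j', a'⟩))‖ ^ 2 :=
          Finset.single_le_sum
            (f := fun j' => ∑ a', ‖ι.h p (b (Sum.inl ⟨j, a⟩)) (b (Sum.inl ⟨j', a'⟩))‖ ^ 2)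
            (fun _ _ => by positivity) (Finset.mem_univ j)
        _ ≤ _ := le_add_of_nonneg_right (by positivity)
    · exact Finset.single_le_sum (f := fun i' => ‖ι.h p (b (Sum.inr l)) (b i')‖ ^ 2)
        (fun _ _ => by positivity) (Finset.mem_univ (Sum.inr l))
  have hcs : ‖T‖ ^ 2 ≤ ((t.k : ℝ) + s) * ∑ x, ‖A x‖ ^ 2 := by
    calc ‖T‖ ^ 2 ≤ (∑ x, ‖A x‖) ^ 2 := by
          rw [hTA]; gcongr; exact norm_sum_le _ _
      _ ≤ _ := by simpa using sq_sum_le_card_mul_sum_sq (s := Finset.univ) (f := fun x => ‖A x‖)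
  have hscal := ι.two_mul_scal p b
  have hsub : 2 * ∑ j, X.subScal p (L j) =
      ∑ j, ‖A (Sum.inl j)‖ ^ 2 - ∑ j, ∑ a, ∑ a', ‖ι.h p (e j a) (e j a')‖ ^ 2 := by
    simp [Finset.mul_sum, ι.two_mul_subScal, A, he]
  have hkey : 2 * (X.scal p - ∑ j, X.subScal p (L j)) ≤ ‖T‖ ^ 2 - ∑ x, ‖A x‖ ^ 2 := by
    rw [mul_sub, hscal, hsub, Fintype.sum_sum_type (fun x => ‖A x‖ ^ 2)]
    linarith
  have hN : ∑ j, t.nn j + s = n := by simpa only [hdim] using hs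
  rw [t.c_mul_eq hN, ι.sq_mul_norm_meanCurvVec_sq p b, ← hT]
  exact le_of_le_mul_of_two_mul_le hcs (by positivity) hkey

/-- Chen's inequality `δ(n₁,…,n_k) ≤ c(n₁,…,n_k) H²`. -/
lemma delta_le (ι : IsometricImmersion m X) (p : X.M) (t : ChenTuple n) :
    X.delta t p ≤ t.c * ‖ι.meanCurvVec p‖ ^ 2 := by
  rw [GeomData.delta, sub_le_comm]
  apply le_csInf
  · obtain ⟨L, hdim, hL⟩ := exists_mutuallyOrthogonal t.nn t.sum_le
    exact ⟨_, L, hdim, hL, rfl⟩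
  · rintro _ ⟨L, hdim, hL, rfl⟩
    linarith [ι.scal_sub_sum_subScal_le p t L hdim hL]

end IsometricImmersion

/-- For any isometric immersion `x : M → 𝔼^m` of a Riemannian `n`-manifold `M`
into a Euclidean `m`-space, the squared mean curvature satisfies
`H² ≥ Δ̂₀(M)` at each point `p ∈ M`, where `Δ̂₀(M)` is the maximum over all
admissible tuples `(n₁,…,n_k)` of the normalized `δ`-invariants
`δ(n₁,…,n_k)/c(n₁,…,n_k)`. -/
theorem squared_mean_curvature_ge_Delta0 {n m : ℕ} (X : GeomData n)
    (ι : IsometricImmersion m X) (p : X.M) :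
    ‖ι.meanCurvVec p‖ ^ 2 ≥ X.Delta0 p := by
  refine Real.sSup_le ?_ (sq_nonneg _)
  rintro _ ⟨t, rfl⟩
  exact div_le_of_le_mul₀ t.c_nonneg (sq_nonneg _) (by linarith [ι.delta_le p t])
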